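/- Let f(x) = (Γ(1/2)/(Γ(1/3)Γ(1/6))) · x^{−2/3}(1−x)^{−5/6} be the density of the Beta(1/3,1/6) distribution and g(y) = (Γ(2)/(Γ(2/3)Γ(4/3))) · y^{−1/3}(1−y)^{1/3} the density of Beta(2/3,4/3), both on (0,1). Then for every natural number n, ∫₀¹∫₀¹ (27xy/4)ⁿ f(x) g(y) dx dy = C(3n,n)/(n+1). -/

import Mathlib

open MeasureTheory

/-- The density of the `Beta(1/3, 1/6)` distribution. -/
noncomputable def f (x : ℝ) : ℝ :=
  (Real.Gamma (1 / 2) / (Real.Gamma (1 / 3) * Real.Gamma (1 / 6))) *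
    x ^ (-(2 : ℝ) / 3) * (1 - x) ^ (-(5 : ℝ) / 6)

/-- The density of the `Beta(2/3, 4/3)` distribution. -/
noncomputable def g (y : ℝ) : ℝ :=
  (Real.Gamma 2 / (Real.Gamma (2 / 3) * Real.Gamma (4 / 3))) *
    y ^ (-(1 : ℝ) / 3) * (1 - y) ^ ((1 : ℝ) / 3)

theorem aux_beta (α β : ℝ) (hα : 0 < α) (hβ : 0 < β) :
    ∫ x in Set.Ioo (0 : ℝ) 1, x ^ (α - 1) * (1 - x) ^ (β - 1)
      = Real.Gamma α * Real.Gamma β / Real.Gamma (α + β) := by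
  have h := ProbabilityTheory.beta_eq_betaIntegralReal α β hα hβ
  rw [ProbabilityTheory.beta] at h
  rw [h, Complex.betaIntegral, intervalIntegral.integral_of_le (by norm_num),
      ← integral_Ioc_eq_integral_Ioo, ← RCLike.re_to_complex, ← integral_re]
  · refine setIntegral_congr_fun measurableSet_Ioc fun x ⟨hx1, hx₂⟩ ↦ ?_
    norm_cast
    rw [← Complex.ofReal_cpow, ← Complex.ofReal_cpow, RCLike.re_to_complex,
      Complex.re_mul_ofReal, Complex.ofReal_re]
    all_goals linarith
  convert! Complex.betaIntegral_convergent (u := α) (v := β) (by simpa) (by simpa)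
  rw [intervalIntegrable_iff_integrableOn_Ioc_of_le (by simp), IntegrableOn]

theorem aux_mom (n : ℕ) (a b c d : ℝ) (hc : 0 < c) (hd : 0 < d) (ha : a = c - 1)
    (hb : b = d - 1) :
    ∫ x in Set.Ioo (0 : ℝ) 1, x ^ n * (x ^ a * (1 - x) ^ b)
      = Real.Gamma (n + c) * Real.Gamma d / Real.Gamma (n + c + d) := by
  rw [← aux_beta (n + c) d (by positivity) hd]
  refine setIntegral_congr_fun measurableSet_Ioo fun x hx ↦ ?_
  have hx0 : 0 < x := hx.1
  rw [show (n : ℝ) + c - 1 = n + a by rw [ha]; ring, Real.rpow_add hx0, Real.rpow_natCast, hb]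
  ring

theorem aux_K (n : ℕ) : (27 : ℝ) ^ n * Real.Gamma (n + 1 / 3) * Real.Gamma (n + 2 / 3) *
    (n.factorial : ℝ) = Real.Gamma (1 / 3) * Real.Gamma (2 / 3) * ((3 * n).factorial : ℝ) := by
  induction n with
  | zero => simp
  | succ k ih =>
    have e1 : ((k + 1 : ℕ) : ℝ) + 1 / 3 = (k + 1 / 3) + 1 := by push_cast; ring
    have e2 : ((k + 1 : ℕ) : ℝ) + 2 / 3 = (k + 2 / 3) + 1 := by push_cast; ring
    rw [e1, e2, Real.Gamma_add_one (by positivity), Real.Gamma_add_one (by positivity),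
      show 3 * (k + 1) = 3 * k + 1 + 1 + 1 by ring]
    simp only [Nat.factorial_succ]
    push_cast
    linear_combination (27 * (k + 1 / 3) * (k + 2 / 3) * (k + 1) : ℝ) * ih

theorem aux_L (n : ℕ) : (4 : ℝ) ^ n * Real.Gamma (n + 1 / 2) *
    (n.factorial : ℝ) = Real.Gamma (1 / 2) * ((2 * n).factorial : ℝ) := by
  induction n with
  | zero => simp
  | succ k ih =>
    have e1 : ((k + 1 : ℕ) : ℝ) + 1 / 2 = (k + 1 / 2) + 1 := by push_cast; ring
    rw [e1, Real.Gamma_add_one (by positivity),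
      show 2 * (k + 1) = 2 * k + 1 + 1 by ring]
    simp only [Nat.factorial_succ]
    push_cast
    linear_combination (4 * (k + 1 / 2) * (k + 1) : ℝ) * ih

theorem stmt_9 (n : ℕ) :
    ∫ x in Set.Ioo (0 : ℝ) 1, ∫ y in Set.Ioo (0 : ℝ) 1,
        (27 * x * y / 4) ^ n * f x * g y
      = (Nat.choose (3 * n) n : ℝ) / (n + 1) := by
  have hG : ∀ x : ℝ, 0 < x → 0 < Real.Gamma x := fun x hx => Real.Gamma_pos_of_pos hx
  have hf := aux_mom n (-(2 : ℝ) / 3) (-(5 : ℝ) / 6) (1 / 3) (1 / 6) (by norm_num) (by norm_num)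
    (by norm_num) (by norm_num)
  have hg := aux_mom n (-(1 : ℝ) / 3) ((1 : ℝ) / 3) (2 / 3) (4 / 3) (by norm_num) (by norm_num)
    (by norm_num) (by norm_num)
  rw [show (n : ℝ) + 1 / 3 + 1 / 6 = n + 1 / 2 by ring] at hf
  rw [show (n : ℝ) + 2 / 3 + 4 / 3 = (n + 1 : ℕ) + 1 by push_cast; ring,
    Real.Gamma_nat_eq_factorial] at hg
  have key : ∀ x y : ℝ, (27 * x * y / 4) ^ n * f x * g y =
      ((27 / 4) ^ n * (Real.Gamma (1 / 2) / (Real.Gamma (1 / 3) * Real.Gamma (1 / 6))) *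
        (Real.Gamma 2 / (Real.Gamma (2 / 3) * Real.Gamma (4 / 3)))) *
      (x ^ n * (x ^ (-(2 : ℝ) / 3) * (1 - x) ^ (-(5 : ℝ) / 6))) *
      (y ^ n * (y ^ (-(1 : ℝ) / 3) * (1 - y) ^ ((1 : ℝ) / 3))) := by
    intro x y
    rw [show 27 * x * y / 4 = 27 / 4 * x * y by ring, mul_pow, mul_pow, f, g]
    ring
  simp_rw [key, integral_const_mul, hg, integral_mul_const, integral_const_mul, hf]
  have hK := aux_K n
  have hL := aux_L n
  have hC : ((3 * n).factorial : ℝ) = (3 * n).choose n * n.factorial * (2 * n).factorial := by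
    have := Nat.choose_mul_factorial_mul_factorial (show n ≤ 3 * n by omega)
    rw [show 3 * n - n = 2 * n by omega] at this
    exact_mod_cast this.symm
  rw [hC] at hK
  have h2 : Real.Gamma 2 = 1 := Real.Gamma_two
  have p1 := hG (1 / 3) (by norm_num)
  have p2 := hG (2 / 3) (by norm_num)
  have p3 := hG (1 / 6) (by norm_num)
  have p4 := hG (4 / 3) (by norm_num)
  have p5 := hG (1 / 2) (by norm_num)
  have p6 := hG (n + 1 / 2) (by positivity)
  have q : (0 : ℝ) < n.factorial := by exact_mod_cast n.factorial_pos
  have q2 : (0 : ℝ) < (2 * n).factorial := by exact_mod_cast (2 * n).factorial_pos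
  rw [h2, Nat.factorial_succ, div_pow]
  push_cast
  generalize Real.Gamma (1 / 3) = a at *
  generalize Real.Gamma (2 / 3) = b at *
  generalize Real.Gamma (1 / 6) = c at *
  generalize Real.Gamma (4 / 3) = d at *
  generalize Real.Gamma (1 / 2) = e at *
  generalize Real.Gamma (n + 1 / 2) = e' at *
  generalize Real.Gamma (n + 1 / 3) = a' at *
  generalize Real.Gamma (n + 2 / 3) = b' at *
  generalize ((3 * n).choose n : ℝ) = C at *
  generalize (n.factorial : ℝ) = F at *
  generalize ((2 * n).factorial : ℝ) = F2 at *
  have h4 : (0 : ℝ) < 4 ^ n := by positivity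
  generalize (4 : ℝ) ^ n = u at *
  generalize (27 : ℝ) ^ n = v at *
  have hn : (0 : ℝ) < n + 1 := by positivity
  have hK' : v * a' * b' = a * b * C * F2 :=
    mul_right_cancel₀ q.ne' (by linear_combination hK)
  have fin : v * e * a' * b' = C * (u * a * b * e' * F) := by
    linear_combination e * hK' - a * b * C * hL
  have : v / u * (e / (a * c)) * (1 / (b * d)) * (a' * c / e') * (b' * d / ((n + 1) * F))
      = (v * e * a' * b') / (u * a * b * e' * F) / (n + 1) := by
    field_simp
  rw [this, fin]; field_simp
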